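/- arXiv:1906.02963 — 9 statements merged into one kernel-verified Lean document; each statement's English description precedes it below -/
import Mathlib

section
/- Let G be a nonempty finite set and S a family of subsets of G. Then there exists a pattern setup (G, (D, ⊑), δ) whose set of definable sets P_ext equals S if and only if for every g ∈ G, the intersection ⋂{E ∈ S | g ∈ E} belongs to S (where the intersection of the empty family is G itself). -/
/-- A family `S` of subsets of a nonempty finite set `G` is the set of definable sets
    of some pattern setup on `G` iff for every `g ∈ G` the intersection of all members
    of `S` containing `g` (which is `G` itself for the empty family) belongs to `S`. -/
theorem stmt_5 {G : Type} [Finite G] [Nonempty G] (S : Set (Set G)) :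
    (∃ (D : Type) (ord : PartialOrder D) (δ : G → D),
        {E : Set G | ∃ d : D, E = {g : G | ord.le d (δ g)}} = S) ↔
    (∀ g : G, ⋂₀ {E ∈ S | g ∈ E} ∈ S) := by
  constructor
  · rintro ⟨D, ord, δ, rfl⟩ g
    refine ⟨δ g, Set.Subset.antisymm ?_ ?_⟩
    · exact Set.sInter_subset_of_mem ⟨⟨δ g, rfl⟩, ord.le_refl _⟩
    · rintro h hh _ ⟨⟨d, rfl⟩, hg⟩
      exact ord.le_trans _ _ _ hg hh
  · intro H
    let δ : G → (S)ᵒᵈ := fun g => OrderDual.toDual ⟨⋂₀ {E ∈ S | g ∈ E}, H g⟩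
    have ext_eq (E : S) : {g : G | OrderDual.toDual E ≤ δ g} = E.1 := by
      ext g
      exact ⟨fun h => h (Set.mem_sInter.2 fun _ hE => hE.2),
        fun h => Set.sInter_subset_of_mem ⟨E.2, h⟩⟩
    refine ⟨(S)ᵒᵈ, inferInstance, δ, Set.Subset.antisymm ?_ ?_⟩
    · rintro _ ⟨d, rfl⟩
      exact (ext_eq (OrderDual.ofDual d)).symm ▸ (OrderDual.ofDual d).2
    · exact fun E hE => ⟨OrderDual.toDual ⟨E, hE⟩, (ext_eq ⟨E, hE⟩).symm⟩
end

section
/- Let (G, (D, ⊑), δ) be a pattern setup with set of definable sets P_ext. Then: (a) for every g ∈ G, ⋂{E ∈ P_ext | g ∈ E} = ext(δ(g)), so this intersection belongs to P_ext; and (b) the pattern setup R(P) = (G, (P_ext, ⊇), δ') with description space P_ext ordered by reverse inclusion and δ'(g) = ⋂{E ∈ P_ext | g ∈ E} satisfies R(P)_ext = P_ext; that is, for every E ∈ P_ext one has {g ∈ G | δ'(g) ⊆ E} = E, and every definable set of R(P) is of this form. -/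
/-- Extent operator of a pattern setup. -/
def ext {G D : Type*} [PartialOrder D] (δ : G → D) (d : D) : Set G := {g | d ≤ δ g}

/-- The set of definable sets `P_ext = {ext(d) | d ∈ D}`. -/
def Pext {G D : Type*} [PartialOrder D] (δ : G → D) : Set (Set G) :=
  {E | ∃ d : D, E = ext δ d}

/-- The description map of the minimal representation `R(P)`:
    `δ'(g) = ⋂ {E ∈ P_ext | g ∈ E}`. -/
def deltaR {G D : Type*} [PartialOrder D] (δ : G → D) (g : G) : Set G :=
  ⋂₀ {E ∈ Pext δ | g ∈ E}

theorem ext_subset_of_mem_ext {G D : Type*} [PartialOrder D] {δ : G → D} {d : D} {g : G}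
    (hg : g ∈ ext δ d) : ext δ (δ g) ⊆ ext δ d :=
  fun _ hx => le_trans hg hx

theorem deltaR_eq_ext {G D : Type*} [PartialOrder D] (δ : G → D) (g : G) :
    deltaR δ g = ext δ (δ g) := by
  apply Set.Subset.antisymm
  · exact Set.sInter_subset_of_mem ⟨⟨δ g, rfl⟩, le_refl (δ g)⟩
  · rintro x hx _ ⟨⟨d, rfl⟩, hg⟩
    exact ext_subset_of_mem_ext hg hx

theorem setOf_deltaR_subset {G D : Type*} [PartialOrder D] {δ : G → D} {E : Set G}
    (hE : E ∈ Pext δ) : {g : G | deltaR δ g ⊆ E} = E := by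
  obtain ⟨d, rfl⟩ := hE
  ext g
  rw [Set.mem_ofPred_eq, deltaR_eq_ext]
  exact ⟨fun h => h (le_refl (δ g)), ext_subset_of_mem_ext⟩

/-- (a) For every `g`, `⋂{E ∈ P_ext | g ∈ E} = ext(δ(g))`, which belongs to `P_ext`;
    (b) the minimal representation `R(P) = (G, (P_ext, ⊇), δ')` satisfies
    `R(P)_ext = P_ext`: the extent in `R(P)` of each `E ∈ P_ext` is `E` itself,
    and every definable set of `R(P)` is of this form. -/
theorem stmt_6 {G D : Type*} [PartialOrder D] (δ : G → D) :
    (∀ g : G, deltaR δ g = ext δ (δ g) ∧ deltaR δ g ∈ Pext δ) ∧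
    (∀ E ∈ Pext δ, {g : G | deltaR δ g ⊆ E} = E) ∧
    {F : Set G | ∃ E ∈ Pext δ, F = {g : G | deltaR δ g ⊆ E}} = Pext δ := by
  refine ⟨fun g => ⟨deltaR_eq_ext δ g, δ g, deltaR_eq_ext δ g⟩,
    fun E hE => setOf_deltaR_subset hE, Set.Subset.antisymm ?_ ?_⟩
  · rintro _ ⟨E, hE, rfl⟩
    rwa [setOf_deltaR_subset hE]
  · exact fun E hE => ⟨E, hE, (setOf_deltaR_subset hE).symm⟩
end

section
/- Let (G, (D, ⊑), δ) be a pattern setup, let A ⊆ G, and suppose d ∈ D is a greatest lower bound (infimum) of δ[A] = {δ(g) | g ∈ A} in (D, ⊑). Then ext(d) = ⋂{E ∈ P_ext | A ⊆ E}; that is, the extent of the infimum of the descriptions of A is the intersection of all definable sets containing A. -/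
/-- If `d` is a greatest lower bound of `δ[A]`, then
    `ext(d) = ⋂ {E ∈ P_ext | A ⊆ E}`. -/
theorem stmt_7 {G D : Type*} [PartialOrder D] (δ : G → D) (A : Set G) (d : D)
    (h : IsGLB (δ '' A) d) :
    ext δ d = ⋂₀ {E ∈ Pext δ | A ⊆ E} := by
  apply Set.Subset.antisymm
  · rintro g hg E ⟨⟨c, rfl⟩, hA⟩
    exact (h.2 (Set.forall_mem_image.2 fun _ ha => hA ha)).trans hg
  · exact Set.sInter_subset_of_mem ⟨⟨d, rfl⟩, fun _ ha => h.1 (Set.mem_image_of_mem δ ha)⟩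
end

section
/- Let (G, (D, ⊑), δ) be a pattern setup. A description d ∈ D is support-closed (i.e., for every c ∈ D with d ⊏ c one has ext(c) ⊊ ext(d)) if and only if there exists a subset A ⊆ G such that d is a maximal element of cov(A). Moreover, in that case d is a maximal element of cov(ext(d)). -/
/-- Cover operator of a pattern setup. -/
def cov {G D : Type*} [PartialOrder D] (δ : G → D) (A : Set G) : Set D :=
  {d | ∀ g ∈ A, d ≤ δ g}

/-- The set of maximal elements of `S`. -/
def maxSet {P : Type*} [PartialOrder P] (S : Set P) : Set P :=
  {x ∈ S | ∀ y ∈ S, x ≤ y → y = x}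

/-- A support-closed description is a maximal element of the cover of its extent. -/
theorem mem_maxSet_cov_ext {G D : Type*} [PartialOrder D] {δ : G → D} {d : D}
    (h : ∀ c : D, d < c → ext δ c ⊂ ext δ d) : d ∈ maxSet (cov δ (ext δ d)) := by
  refine ⟨fun _ hg => hg, fun c hc hdc => ?_⟩
  by_contra hne
  exact (h c (lt_of_le_of_ne hdc (Ne.symm hne))).not_subset hc

/-- A maximal element of the cover of a set of objects is support-closed. -/
theorem ext_ssubset_of_mem_maxSet_cov {G D : Type*} [PartialOrder D] {δ : G → D} {d : D}
    {A : Set G} (hd : d ∈ maxSet (cov δ A)) (c : D) (hdc : d < c) : ext δ c ⊂ ext δ d :=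
  ⟨fun _ hg => hdc.le.trans hg, fun hsub =>
    hdc.ne' (hd.2 c (fun g hg => hsub (hd.1 g hg)) hdc.le)⟩

/-- A description is support-closed iff it is a maximal element of `cov(A)` for some
    `A ⊆ G`; in that case it is a maximal element of `cov(ext(d))`. -/
theorem stmt_10 {G D : Type*} [PartialOrder D] (δ : G → D) (d : D) :
    ((∀ c : D, d < c → ext δ c ⊂ ext δ d) ↔ ∃ A : Set G, d ∈ maxSet (cov δ A)) ∧
    ((∀ c : D, d < c → ext δ c ⊂ ext δ d) → d ∈ maxSet (cov δ (ext δ d))) :=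
  ⟨⟨fun h => ⟨ext δ d, mem_maxSet_cov_ext h⟩,
    fun ⟨_, hd⟩ => ext_ssubset_of_mem_maxSet_cov hd⟩, mem_maxSet_cov_ext⟩
end

section
/- Let (P, ≤) be a poset in which every chain has a least upper bound (a chain-complete poset). Then (P, ≤) is a complete meet-multisemilattice: for every subset S ⊆ P, the set of lower bounds Sˡ satisfies Sˡ = ↓max(Sˡ); that is, every lower bound of S lies below some maximal lower bound of S. -/
/-- Downward closure of a set in a poset. -/
def downClo {P : Type*} [PartialOrder P] (T : Set P) : Set P := {x | ∃ t ∈ T, x ≤ t}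

/-- Every chain-complete poset is a complete meet-multisemilattice: for every subset `S`,
    `Sˡ = ↓max(Sˡ)`. -/
theorem stmt_11 {P : Type*} [PartialOrder P]
    (hcc : ∀ C : Set P, IsChain (· ≤ ·) C → ∃ j : P, IsLUB C j) :
    ∀ S : Set P, lowerBounds S = downClo (maxSet (lowerBounds S)) := by
  intro S
  ext x
  constructor
  · intro hx
    obtain ⟨m, hxm, hm⟩ := zorn_le_nonempty₀ (lowerBounds S) (fun C hCS hC _ _ => by
      obtain ⟨j, hj⟩ := hcc C hC
      exact ⟨j, fun s hs => hj.2 fun c hc => hCS hc hs, hj.1⟩) x hx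
    exact ⟨m, ⟨hm.prop, fun y hy hmy => (hm.eq_of_le hy hmy).symm⟩, hxm⟩
  · rintro ⟨m, ⟨hm, -⟩, hxm⟩ s hs
    exact hxm.trans (hm hs)
end

section
/- Let (G, (D, ⊑), δ) be a pattern multistructure. Then for every A ⊆ G, the set of upper-approximation extents of A equals the set of minimal elements (with respect to ⊆) of the extents of the maximal covering descriptions of A: min({E ∈ P_ext | A ⊆ E}) = min({ext(d) | d ∈ max(cov(A))}). -/
/-- The set of minimal elements of `S`. -/
def minSet {P : Type*} [PartialOrder P] (S : Set P) : Set P :=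
  {x ∈ S | ∀ y ∈ S, y ≤ x → y = x}

theorem minSet_eq_of_subset_of_forall_exists_le {P : Type*} [PartialOrder P] {S T : Set P}
    (hTS : T ⊆ S) (hST : ∀ s ∈ S, ∃ t ∈ T, t ≤ s) : minSet S = minSet T := by
  apply Set.Subset.antisymm
  · rintro x ⟨hx, hmin⟩
    obtain ⟨t, ht, htx⟩ := hST x hx
    obtain rfl := hmin t (hTS ht) htx
    exact ⟨ht, fun y hy => hmin y (hTS hy)⟩
  · rintro x ⟨hx, hmin⟩
    refine ⟨hTS hx, fun y hy hyx => ?_⟩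
    obtain ⟨t, ht, hty⟩ := hST y hy
    obtain rfl := hmin t ht (hty.trans hyx)
    exact le_antisymm hyx hty

theorem ext_antitone {G D : Type*} [PartialOrder D] (δ : G → D) : Antitone (ext δ) :=
  fun _ _ h _ hg => le_trans h hg

/-- In a pattern multistructure, the upper-approximation extents of `A` are the minimal
    extents of the maximal covering descriptions of `A`:
    `min({E ∈ P_ext | A ⊆ E}) = min(ext[max(cov(A))])`. -/
theorem stmt_13 {G D : Type*} [PartialOrder D] (δ : G → D)
    (hms : ∀ A : Set G, cov δ A = downClo (maxSet (cov δ A))) (A : Set G) :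
    minSet {E | E ∈ Pext δ ∧ A ⊆ E} =
      minSet {E : Set G | ∃ d ∈ maxSet (cov δ A), E = ext δ d} := by
  refine minSet_eq_of_subset_of_forall_exists_le ?_ ?_
  · rintro _ ⟨d, hd, rfl⟩
    exact ⟨⟨d, rfl⟩, hd.1⟩
  · rintro _ ⟨⟨d, rfl⟩, hA⟩
    have hd : d ∈ downClo (maxSet (cov δ A)) := hms A ▸ (fun _ hg => hA hg : d ∈ cov δ A)
    obtain ⟨m, hm, hdm⟩ := hd
    exact ⟨ext δ m, ⟨m, hm, rfl⟩, ext_antitone δ hdm⟩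
end

section
/- Let (G, (D, ⊑), δ) be a pattern multistructure and let D* denote its set of support-closed descriptions. Then P_ext = {ext(d) | d ∈ D*}; that is, every definable set is the extent of some support-closed description. -/
/-- A description `d` is support-closed if `d ⊏ c` implies `ext(c) ⊊ ext(d)`. -/
def SupportClosed {G D : Type*} [PartialOrder D] (δ : G → D) (d : D) : Prop :=
  ∀ c : D, d < c → ext δ c ⊂ ext δ d

/-- In a pattern multistructure, every definable set is the extent of some
    support-closed description: `P_ext = ext[D*]`. -/
theorem stmt_14 {G D : Type*} [PartialOrder D] (δ : G → D)
    (hms : ∀ A : Set G, cov δ A = downClo (maxSet (cov δ A))) :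
    {E : Set G | ∃ d : D, E = ext δ d} =
      {E : Set G | ∃ d : D, SupportClosed δ d ∧ E = ext δ d} := by
  ext E
  constructor
  · rintro ⟨d, rfl⟩
    have hd : d ∈ cov δ (_root_.ext δ d) := fun _ hg => hg
    rw [hms] at hd
    obtain ⟨t, ⟨ht, hmax⟩, hdt⟩ := hd
    have h_ext : _root_.ext δ d = _root_.ext δ t :=
      Set.Subset.antisymm (fun g hg => ht g hg) (fun _ hg => le_trans hdt hg)
    refine ⟨t, fun c hc => ⟨fun _ hg => le_trans hc.le hg, fun hsub => ?_⟩, h_ext⟩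
    have hct : c = t := hmax c (fun g hg => hsub (ht g hg)) hc.le
    exact hc.ne hct.symm
  · rintro ⟨d, -, h⟩
    exact ⟨d, h⟩
end

section
/- Let (P, ≤) be a poset. (1) If for every pair of antichains A, B of P there exists an antichain C with ↓A ∩ ↓B = ↓C (i.e., the antichain completion of P is a lattice), then P is a meet-multisemilattice: every nonempty finite subset S ⊆ P satisfies Sˡ = ↓max(Sˡ). (2) If moreover there exists an antichain C with P = ↓C (i.e., the antichain completion has a top element), then P = ↓max(P). -/
theorem downClo_singleton {P : Type*} [PartialOrder P] (a : P) :
    downClo {a} = Set.Iic a := by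
  ext x
  simp [downClo]

/-- An antichain is the set of maximal elements of its downward closure. -/
theorem maxSet_downClo {P : Type*} [PartialOrder P] {C : Set P}
    (hC : IsAntichain (· ≤ ·) C) : maxSet (downClo C) = C := by
  ext x
  constructor
  · rintro ⟨⟨c, hc, hxc⟩, hmax⟩
    exact hmax c ⟨c, hc, le_rfl⟩ hxc ▸ hc
  · intro hx
    refine ⟨⟨x, hx, le_rfl⟩, ?_⟩
    rintro y ⟨c, hc, hyc⟩ hxy
    obtain rfl := hC.eq hx hc (hxy.trans hyc)
    exact le_antisymm hyc hxy

theorem exists_antichain_lowerBounds_eq {P : Type*} [PartialOrder P]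
    (h : ∀ A B : Set P, IsAntichain (· ≤ ·) A → IsAntichain (· ≤ ·) B →
      ∃ C : Set P, IsAntichain (· ≤ ·) C ∧ downClo A ∩ downClo B = downClo C)
    {S : Set P} (hne : S.Nonempty) (hfin : S.Finite) :
    ∃ C : Set P, IsAntichain (· ≤ ·) C ∧ lowerBounds S = downClo C := by
  induction S, hfin using Set.Finite.induction_on with
  | empty => exact absurd hne Set.not_nonempty_empty
  | @insert a T _ _ ih =>
    have ha : IsAntichain (· ≤ ·) ({a} : Set P) := Set.subsingleton_singleton.isAntichain _
    rcases T.eq_empty_or_nonempty with rfl | hT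
    · exact ⟨{a}, ha, by simp [downClo_singleton]⟩
    · obtain ⟨B, hB, hTB⟩ := ih hT
      obtain ⟨C, hC, hBC⟩ := h {a} B ha hB
      exact ⟨C, hC, by rw [lowerBounds_insert, hTB, ← hBC, downClo_singleton]⟩

/-- (1) If the antichain completion of `P` is a lattice (for all antichains `A, B` there
    is an antichain `C` with `↓A ∩ ↓B = ↓C`), then `P` is a meet-multisemilattice:
    every nonempty finite `S ⊆ P` satisfies `Sˡ = ↓max(Sˡ)`.
    (2) If moreover the antichain completion has a top element (an antichain `C` with
    `P = ↓C`), then `P = ↓max(P)`. -/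
theorem stmt_18 {P : Type*} [PartialOrder P] :
    ((∀ A B : Set P, IsAntichain (· ≤ ·) A → IsAntichain (· ≤ ·) B →
        ∃ C : Set P, IsAntichain (· ≤ ·) C ∧ downClo A ∩ downClo B = downClo C) →
      ∀ S : Set P, S.Nonempty → S.Finite →
        lowerBounds S = downClo (maxSet (lowerBounds S))) ∧
    ((∀ A B : Set P, IsAntichain (· ≤ ·) A → IsAntichain (· ≤ ·) B →
        ∃ C : Set P, IsAntichain (· ≤ ·) C ∧ downClo A ∩ downClo B = downClo C) →
      (∃ C : Set P, IsAntichain (· ≤ ·) C ∧ (Set.univ : Set P) = downClo C) →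
      (Set.univ : Set P) = downClo (maxSet (Set.univ : Set P))) := by
  refine ⟨fun h S hne hfin => ?_, fun _ ⟨C, hC, hPC⟩ => ?_⟩
  · obtain ⟨C, hC, hSC⟩ := exists_antichain_lowerBounds_eq h hne hfin
    rw [hSC, maxSet_downClo hC]
  · rw [hPC, maxSet_downClo hC]
end

section
/- Let (G, (D, ⊑), δ) be a pattern setup. The antichain completion of this pattern setup is a pattern structure if and only if the pattern setup is a pattern multistructure. Explicitly: (for every A ⊆ G there exists an antichain M ⊆ cov(A) such that every antichain S ⊆ cov(A) satisfies ↓S ⊆ ↓M) holds if and only if (for every A ⊆ G, cov(A) = ↓max(cov(A))); and in that case, for every A ⊆ G such an M is exactly max(cov(A)). -/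
theorem isLowerSet_cov {G D : Type*} [PartialOrder D] (δ : G → D) (A : Set G) :
    IsLowerSet (cov δ A) :=
  fun _ _ hba ha g hg => hba.trans (ha g hg)

theorem maxSet_subset {P : Type*} [PartialOrder P] (S : Set P) : maxSet S ⊆ S :=
  fun _ hx => hx.1

theorem isAntichain_maxSet {P : Type*} [PartialOrder P] (S : Set P) :
    IsAntichain (· ≤ ·) (maxSet S) :=
  fun _ hx y hy hne hle => hne (hx.2 y hy.1 hle).symm

theorem subset_downClo {P : Type*} [PartialOrder P] (S : Set P) : S ⊆ downClo S :=
  fun x hx => ⟨x, hx, le_rfl⟩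

theorem downClo_subset_of_subset {P : Type*} [PartialOrder P] {S T : Set P}
    (hT : IsLowerSet T) (h : S ⊆ T) : downClo S ⊆ T := by
  rintro x ⟨s, hs, hxs⟩
  exact hT hxs (h hs)

/-- A set whose antichains are all dominated by `M` is contained in the downward closure
of `M`. -/
theorem subset_downClo_of_forall_antichain {P : Type*} [PartialOrder P] {C M : Set P}
    (h : ∀ S : Set P, IsAntichain (· ≤ ·) S → S ⊆ C → downClo S ⊆ downClo M) :
    C ⊆ downClo M :=
  fun x hx => h {x} (Set.subsingleton_singleton.isAntichain _)
    (Set.singleton_subset_iff.2 hx) (subset_downClo _ rfl)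

/-- An antichain of `C` whose downward closure contains `C` consists of the maximal elements
of `C`. -/
theorem eq_maxSet_of_subset_downClo {P : Type*} [PartialOrder P] {C M : Set P}
    (hM : IsAntichain (· ≤ ·) M) (hMC : M ⊆ C) (h : C ⊆ downClo M) : M = maxSet C := by
  apply Set.Subset.antisymm
  · intro m hm
    refine ⟨hMC hm, fun y hy hmy => ?_⟩
    obtain ⟨m', hm', hym'⟩ := h hy
    obtain rfl := hM.eq hm hm' (hmy.trans hym')
    exact hym'.antisymm hmy
  · intro x hx
    obtain ⟨m, hm, hxm⟩ := h hx.1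
    exact hx.2 m (hMC hm) hxm ▸ hm

/-- The antichain completion of a pattern setup is a pattern structure (for every
    `A ⊆ G` there is an antichain `M ⊆ cov(A)` dominating, w.r.t. `↓`, every antichain
    contained in `cov(A)`) iff the pattern setup is a pattern multistructure
    (`cov(A) = ↓max(cov(A))` for all `A`); and in that case any such `M` equals
    `max(cov(A))`. -/
theorem stmt_19 {G D : Type*} [PartialOrder D] (δ : G → D) :
    ((∀ A : Set G, ∃ M : Set D, IsAntichain (· ≤ ·) M ∧ M ⊆ cov δ A ∧
        ∀ S : Set D, IsAntichain (· ≤ ·) S → S ⊆ cov δ A → downClo S ⊆ downClo M) ↔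
      (∀ A : Set G, cov δ A = downClo (maxSet (cov δ A)))) ∧
    ((∀ A : Set G, cov δ A = downClo (maxSet (cov δ A))) →
      ∀ A : Set G, ∀ M : Set D, IsAntichain (· ≤ ·) M → M ⊆ cov δ A →
        (∀ S : Set D, IsAntichain (· ≤ ·) S → S ⊆ cov δ A → downClo S ⊆ downClo M) →
        M = maxSet (cov δ A)) := by
  refine ⟨⟨fun h A => ?_, fun h A => ?_⟩, fun _ A M hM hMC hdom =>
    eq_maxSet_of_subset_downClo hM hMC (subset_downClo_of_forall_antichain hdom)⟩
  · obtain ⟨M, hM, hMC, hdom⟩ := h A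
    have hC := subset_downClo_of_forall_antichain hdom
    rw [← eq_maxSet_of_subset_downClo hM hMC hC]
    exact hC.antisymm (downClo_subset_of_subset (isLowerSet_cov δ A) hMC)
  · refine ⟨maxSet (cov δ A), isAntichain_maxSet _, maxSet_subset _, fun S _ hS => ?_⟩
    rw [← h A]
    exact downClo_subset_of_subset (isLowerSet_cov δ A) hS
end
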